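/- Let F be a properly parametrized Markov multi-map with forward trajectory space X, and let π_n: X→X_n be the projection x↦(x₀,…,x_{n−1}). Let n≥2 and suppose U_n⊂X_n is open with π_n^{-1}(U_n) nonempty. Then there exists a special labeled finite trajectory (z,u)∈S_n with z∈U_n and with the word u of length n−1 occurring in E (i.e., all letters of u are essential and u occurs in an essential symbolic sequence). -/

import Mathlib

open Set Topology

/-! ### Generic dynamical notions -/

/-- Topological transitivity of a map. -/
def TopTransitive {α : Type*} [TopologicalSpace α] (T : α → α) : Prop :=
  ∀ U V : Set α, IsOpen U → IsOpen V → U.Nonempty → V.Nonempty →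
    ∃ n : ℕ, (T^[n] '' U ∩ V).Nonempty

/-- Topological mixing of a map. -/
def TopMixing {α : Type*} [TopologicalSpace α] (T : α → α) : Prop :=
  ∀ U V : Set α, IsOpen U → IsOpen V → U.Nonempty → V.Nonempty →
    ∃ N : ℕ, ∀ n, N ≤ n → (T^[n] '' U ∩ V).Nonempty

/-- Density of the set of periodic points of a map. -/
def DensePeriodic {α : Type*} [TopologicalSpace α] (T : α → α) : Prop :=
  Dense {x : α | ∃ p : ℕ, 1 ≤ p ∧ T^[p] x = x}

/-- The metric `d(x,y) = sup_k |x_k - y_k|/(k+1)` on sequence spaces. -/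
noncomputable def dseq (x y : ℕ → ℝ) : ℝ := ⨆ k : ℕ, |x k - y k| / ((k : ℝ) + 1)

/-- The specification property for a map `T` with respect to a distance function `d`. -/
def SpecProp {α : Type*} (T : α → α) (d : α → α → ℝ) : Prop :=
  ∀ ε : ℝ, 0 < ε → ∃ N : ℕ, ∀ l : ℕ, ∀ x : Fin (l + 1) → α, ∀ a b : Fin (l + 1) → ℕ,
    (∀ k, 1 ≤ a k) → (∀ k, a k ≤ b k) →
    (∀ k : Fin l, b k.castSucc < a k.succ ∧ b k.castSucc + N ≤ a k.succ) →
    ∀ p : ℕ, b (Fin.last l) + N ≤ p →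
      ∃ z : α, T^[p] z = z ∧
        ∀ k : Fin (l + 1), ∀ i : ℕ, a k ≤ i → i ≤ b k → d (T^[i] z) (T^[i] (x k)) < ε

/-- The length `ℓ` of a (possibly degenerate) interval. -/
noncomputable def intervalLen (I : Set ℝ) : ℝ := sSup I - sInf I

/-! ### Markov multi-maps -/

/-- A Markov multi-map of the interval, given by a tuple
`(P, A₀, A₁, A₂, D, R, {f_a})` as in the paper, together with the derived data
(inverse maps `g`, interiors `D0`, `R0`, graphs `Gr`, `G0`) which are uniquely
determined by the defining equations below. -/
structure MarkovMultiMap where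
  A : Type
  finA : Finite A
  A0 : Set A
  A1 : Set A
  A2 : Set A
  P : Finset ℝ
  D : A → Set ℝ
  R : A → Set ℝ
  f : A → ℝ → ℝ
  g : A → ℝ → ℝ
  D0 : A → Set ℝ
  R0 : A → Set ℝ
  Gr : A → Set (ℝ × ℝ)
  G0 : A → Set (ℝ × ℝ)
  P_zero : (0 : ℝ) ∈ P
  P_one : (1 : ℝ) ∈ P
  P_sub : (P : Set ℝ) ⊆ Set.Icc 0 1
  A_cover : ∀ a : A, a ∈ A0 ∨ a ∈ A1 ∨ a ∈ A2
  A01 : A0 ∩ A1 = ∅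
  A02 : A0 ∩ A2 = ∅
  A12 : A1 ∩ A2 = ∅
  D_A0 : ∀ a ∈ A0, ∃ p ∈ P, ∃ q ∈ P, p < q ∧ (∀ r ∈ P, ¬(p < r ∧ r < q)) ∧ D a = Set.Icc p q
  D_A12 : ∀ a ∈ A1 ∪ A2, ∃ p ∈ P, D a = {p}
  R_A0 : ∀ a ∈ A0, ∃ u ∈ P, ∃ v ∈ P, u < v ∧ R a = Set.Icc u v
  R_A1 : ∀ a ∈ A1, ∃ u ∈ P, ∃ v ∈ P, u < v ∧ R a = Set.Icc u v ∧
    Set.Icc u v ∩ (P : Set ℝ) = {u, v}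
  R_A2 : ∀ a ∈ A2, ∃ u ∈ P, R a = {u}
  f_homeo : ∀ a ∈ A0, ContinuousOn (f a) (D a) ∧ Set.BijOn (f a) (D a) (R a)
  g_A0 : ∀ a ∈ A0, (∀ x ∈ D a, g a (f a x) = x) ∧ ∀ y ∈ R a, g a y ∈ D a ∧ f a (g a y) = y
  g_A12 : ∀ a ∈ A1 ∪ A2, ∀ y ∈ R a, g a y ∈ D a
  cover : Set.Icc (0 : ℝ) 1 = ⋃ a : A, D a
  D0_A0 : ∀ a ∈ A0, D0 a = interior (D a)
  D0_A12 : ∀ a ∈ A1 ∪ A2, D0 a = D a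
  R0_A01 : ∀ a ∈ A0 ∪ A1, R0 a = interior (R a)
  R0_A2 : ∀ a ∈ A2, R0 a = R a
  Gr_A0 : ∀ a ∈ A0, Gr a = {q : ℝ × ℝ | q.1 ∈ D a ∧ q.2 = f a q.1}
  Gr_A12 : ∀ a ∈ A1 ∪ A2, Gr a = (D a) ×ˢ (R a)
  G0_A0 : ∀ a ∈ A0, G0 a = {q : ℝ × ℝ | q.1 ∈ D0 a ∧ q.2 = f a q.1}
  G0_A1 : ∀ a ∈ A1, G0 a = (D a) ×ˢ (R0 a)
  G0_A2 : ∀ a ∈ A2, G0 a = Gr a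

namespace MarkovMultiMap

variable (M : MarkovMultiMap)

/-- The graph `G(F)` of the multi-map. -/
def GF : Set (ℝ × ℝ) := ⋃ a : M.A, M.Gr a

/-- `F` is properly parametrized: the sets `G₀(a)` partition `G(F)`. -/
def ProperlyParametrized : Prop :=
  (⋃ a : M.A, M.G0 a) = M.GF ∧ ∀ a b : M.A, a ≠ b → Disjoint (M.G0 a) (M.G0 b)

/-- The forward trajectory space `X`. -/
def X : Set (ℕ → ℝ) :=
  {x | (∀ k, x k ∈ Set.Icc (0 : ℝ) 1) ∧ ∀ k, (x k, x (k + 1)) ∈ M.GF}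

/-- The left-shift map `T` on the forward trajectory space. -/
def shift : M.X → M.X :=
  fun x => ⟨fun k => x.1 (k + 1), ⟨fun k => x.2.1 (k + 1), fun k => x.2.2 (k + 1)⟩⟩

/-- The inverse trajectory (inverse limit) space `Y`, encoded by `y k = y_{-k}`. -/
def Y : Set (ℕ → ℝ) :=
  {y | (∀ k, y k ∈ Set.Icc (0 : ℝ) 1) ∧ ∀ k, (y (k + 1), y k) ∈ M.GF}

/-- The right-shift map `S` on the inverse limit space (in the encoding `y k = y_{-k}`). -/
def ishift : M.Y → M.Y :=
  fun y => ⟨fun k => y.1 (k + 1), ⟨fun k => y.2.1 (k + 1), fun k => y.2.2 (k + 1)⟩⟩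

/-- The space `X_n` of finite trajectories of length `n`. -/
def finTraj (n : ℕ) : Set (Fin n → ℝ) :=
  {x | (∀ i, x i ∈ Set.Icc (0 : ℝ) 1) ∧
    ∀ i : Fin n, ∀ h : (i : ℕ) + 1 < n, (x i, x ⟨(i : ℕ) + 1, h⟩) ∈ M.GF}

/-- The associated nearest-neighbor SFT `Σ_M`. -/
def SFT : Set (ℕ → M.A) := {a | ∀ n : ℕ, M.D0 (a (n + 1)) ⊆ M.R0 (a n)}

/-- The word `u` (of length `n`) occurs in some point of `Z`. -/
def WordIn {n : ℕ} (u : Fin n → M.A) (Z : Set (ℕ → M.A)) : Prop :=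
  ∃ z ∈ Z, ∃ m : ℕ, ∀ i : Fin n, u i = z (m + (i : ℕ))

/-- `L_n`, the words of length `n` in the language of `Σ_M`. -/
def Lang (n : ℕ) : Set (Fin n → M.A) := {u | M.WordIn u M.SFT}

/-- `(x,u)` is a labeled finite trajectory: `(x_k, x_{k+1}) ∈ G(u_k)` for all `k`. -/
def Labeled {n : ℕ} (x : Fin (n + 1) → ℝ) (u : Fin n → M.A) : Prop :=
  ∀ i : Fin n, (x i.castSucc, x i.succ) ∈ M.Gr (u i)

/-- `(x,u)` is a special labeled finite trajectory: `(x_k, x_{k+1}) ∈ G₀(u_k)` for all `k`. -/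
def SpecialLabeled {n : ℕ} (x : Fin (n + 1) → ℝ) (u : Fin n → M.A) : Prop :=
  ∀ i : Fin n, (x i.castSucc, x i.succ) ∈ M.G0 (u i)

/-- A word `u ∈ L_n` is essential if the set of finite trajectories specially labeled
by `u` is open in `X_{n+1}`. -/
def EssentialWord {n : ℕ} (u : Fin n → M.A) : Prop :=
  u ∈ M.Lang n ∧ IsOpen {x : M.finTraj (n + 1) | M.SpecialLabeled x.1 u}

/-- A symbol is essential if it appears in some essential word. -/
def EssentialSymbol (a : M.A) : Prop :=
  ∃ n : ℕ, ∃ u : Fin n → M.A, M.EssentialWord u ∧ ∃ i : Fin n, u i = a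

/-- `A^(e)`, the set of essential symbols. -/
def Ess : Set M.A := {a | M.EssentialSymbol a}

/-- `E`, the set of essential symbolic sequences. -/
def E : Set (ℕ → M.A) := {z ∈ M.SFT | ∀ i : ℕ, z i ∈ M.Ess}

/-- A word all of whose letters lie in `C`, in the language of `Σ_M`. -/
def WordOver {n : ℕ} (u : Fin n → M.A) (C : Set M.A) : Prop :=
  u ∈ M.Lang n ∧ ∀ i, u i ∈ C

/-- There is a word of length `n+1` over `C` beginning with `a` and ending with `b`. -/
def WordFromTo (C : Set M.A) (a b : M.A) (n : ℕ) : Prop :=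
  ∃ u : Fin (n + 1) → M.A, M.WordOver u C ∧ u 0 = a ∧ u (Fin.last n) = b

/-- `C ⊆ A` is irreducible. -/
def IrreducibleSet (C : Set M.A) : Prop :=
  ∀ a ∈ C, ∀ b ∈ C, ∃ n : ℕ, M.WordFromTo C a b n

/-- `C` is an irreducible component (a maximal irreducible subset of `A`). -/
def IrreducibleComponent (C : Set M.A) : Prop :=
  M.IrreducibleSet C ∧ ∀ C' : Set M.A, M.IrreducibleSet C' → C ⊆ C' → C' = C

/-- `C ⊆ A` is mixing. -/
def MixingSet (C : Set M.A) : Prop :=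
  ∃ N : ℕ, 1 ≤ N ∧ ∀ a ∈ C, ∀ b ∈ C, ∀ n : ℕ, N ≤ n + 1 → M.WordFromTo C a b n

/-- `C` is a mixing component (a maximal mixing subset of `A`). -/
def MixingComponent (C : Set M.A) : Prop :=
  M.MixingSet C ∧ ∀ C' : Set M.A, M.MixingSet C' → C ⊆ C' → C' = C

/-- The Irreducibility Condition (IC). -/
def IC : Prop := ∃ C : Set M.A, M.IrreducibleComponent C ∧ M.Ess ⊆ C

/-- The Mixing Condition (MC). -/
def MC : Prop := ∃ C : Set M.A, M.MixingComponent C ∧ M.Ess ⊆ C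

/-- `Z` is a subshift of `Σ_M`: shift-invariant and closed in the product of discrete
topologies (closedness phrased combinatorially). -/
def IsSubshift (Z : Set (ℕ → M.A)) : Prop :=
  Z ⊆ M.SFT ∧ (∀ z ∈ Z, (fun k => z (k + 1)) ∈ Z) ∧
  ∀ x : ℕ → M.A, (∀ n : ℕ, ∃ z ∈ Z, ∀ i, i < n → z i = x i) → x ∈ Z

/-- The symbol `a` occurs in some point of `Z`. -/
def SymbolInShift (Z : Set (ℕ → M.A)) (a : M.A) : Prop := ∃ z ∈ Z, ∃ k : ℕ, z k = a

/-- `Z` is transitive on symbols. -/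
def TransitiveOnSymbols (Z : Set (ℕ → M.A)) : Prop :=
  ∀ a b : M.A, M.SymbolInShift Z a → M.SymbolInShift Z b →
    ∃ z ∈ Z, ∃ m n : ℕ, z m = a ∧ z (m + n) = b

end MarkovMultiMap

/-- The composition `g_{u₀} ∘ ⋯ ∘ g_{u_n}` of inverse maps along a list of symbols. -/
def gWordList (M : MarkovMultiMap) : List M.A → ℝ → ℝ
  | [], x => x
  | a :: l, x => M.g a (gWordList M l x)

namespace MarkovMultiMap

/-- The inverse map `g_u` associated to a word `u = u₀⋯u_n`. -/
def gWord (M : MarkovMultiMap) {n : ℕ} (u : Fin (n + 1) → M.A) : ℝ → ℝ :=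
  gWordList M (List.ofFn u)

/-- The interval `I_u = g_u(R(u_n))`. -/
def Iword (M : MarkovMultiMap) {n : ℕ} (u : Fin (n + 1) → M.A) : Set ℝ :=
  M.gWord u '' M.R (u (Fin.last n))

/-- The Coding Condition (CC). -/
def CC (M : MarkovMultiMap) : Prop :=
  ∃ Z : Set (ℕ → M.A), M.IsSubshift Z ∧ M.TransitiveOnSymbols Z ∧
    (∀ y ∈ Set.Icc (0 : ℝ) 1, ∃ a ∈ Z, ∃ x ∈ M.X, x 0 = y ∧
      ∀ i : ℕ, (x i, x (i + 1)) ∈ M.Gr (a i)) ∧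
    (∀ ε : ℝ, 0 < ε → ∃ N : ℕ, ∀ n : ℕ, N ≤ n → ∀ u : Fin (n + 1) → M.A,
      M.WordIn u Z → intervalLen (M.Iword u) < ε)

/-- Uniform equicontinuity of the family `{g_u : u ∈ L(C)}`. -/
def UnifEquicontOn (M : MarkovMultiMap) (C : Set M.A) : Prop :=
  ∀ ε : ℝ, 0 < ε → ∃ δ : ℝ, 0 < δ ∧ ∀ n : ℕ, ∀ u : Fin (n + 1) → M.A, M.WordOver u C →
    ∀ x ∈ M.R (u (Fin.last n)), ∀ y ∈ M.R (u (Fin.last n)),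
      |x - y| < δ → |M.gWord u x - M.gWord u y| < ε

end MarkovMultiMap

namespace MarkovMultiMap

variable {M : MarkovMultiMap}

lemma mem_A2_of_notMem {a : M.A} (h0 : a ∉ M.A0) (h1 : a ∉ M.A1) : a ∈ M.A2 := by
  rcases M.A_cover a with h | h | h
  · exact absurd h h0
  · exact absurd h h1
  · exact h

/-- Explicit description of the data of a symbol in `A₀`. -/
lemma A0_data {a : M.A} (ha : a ∈ M.A0) :
    ∃ p ∈ M.P, ∃ q ∈ M.P, ∃ u ∈ M.P, ∃ v ∈ M.P, p < q ∧ u < v ∧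
      (∀ r ∈ M.P, ¬(p < r ∧ r < q)) ∧ M.D a = Icc p q ∧ M.D0 a = Ioo p q ∧
      M.R a = Icc u v ∧ M.R0 a = Ioo u v ∧
      M.f a p ∈ M.P ∧ M.f a q ∈ M.P ∧ MapsTo (M.f a) (Ioo p q) (Ioo u v) := by
  obtain ⟨p, hp, q, hq, hpq, hgap, hD⟩ := M.D_A0 a ha
  obtain ⟨u, hu, v, hv, huv, hR⟩ := M.R_A0 a ha
  obtain ⟨hc, hmap, hinj, hsurj⟩ := M.f_homeo a ha
  rw [hD] at hc hmap hinj hsurj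
  rw [hR] at hmap hsurj
  have hpm : p ∈ Icc p q := left_mem_Icc.2 hpq.le
  have hqm : q ∈ Icc p q := right_mem_Icc.2 hpq.le
  obtain ⟨s, hs, hsu⟩ := hsurj (left_mem_Icc.2 huv.le)
  obtain ⟨t, ht, htv⟩ := hsurj (right_mem_Icc.2 huv.le)
  have hfp := hmap hpm
  have hfq := hmap hqm
  refine ⟨p, hp, q, hq, u, hu, v, hv, hpq, huv, hgap, hD, ?_, hR, ?_, ?_⟩
  · rw [M.D0_A0 a ha, hD, interior_Icc]
  · rw [M.R0_A01 a (Or.inl ha), hR, interior_Icc]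
  rcases hc.strictMonoOn_of_injOn_Icc' hpq.le hinj with hm | hm
  · have h1 : M.f a p = u :=
      le_antisymm (hsu ▸ hm.monotoneOn hpm hs hs.1) hfp.1
    have h2 : M.f a q = v :=
      le_antisymm hfq.2 (htv ▸ hm.monotoneOn ht hqm ht.2)
    refine ⟨h1 ▸ hu, h2 ▸ hv, fun x hx => ⟨?_, ?_⟩⟩
    · exact h1 ▸ hm hpm (Ioo_subset_Icc_self hx) hx.1
    · exact h2 ▸ hm (Ioo_subset_Icc_self hx) hqm hx.2
  · have h1 : M.f a p = v :=
      le_antisymm hfp.2 (htv ▸ hm.antitoneOn hpm ht ht.1)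
    have h2 : M.f a q = u :=
      le_antisymm (hsu ▸ hm.antitoneOn hs hqm hs.2) hfq.1
    refine ⟨h1 ▸ hv, h2 ▸ hu, fun x hx => ⟨?_, ?_⟩⟩
    · exact h2 ▸ hm (Ioo_subset_Icc_self hx) hqm hx.2
    · exact h1 ▸ hm hpm (Ioo_subset_Icc_self hx) hx.1

/-- Explicit description of the data of a symbol in `A₁`. -/
lemma A1_data {a : M.A} (ha : a ∈ M.A1) :
    ∃ p ∈ M.P, ∃ u ∈ M.P, ∃ v ∈ M.P, u < v ∧ (∀ r ∈ M.P, r ∉ Ioo u v) ∧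
      M.D a = {p} ∧ M.D0 a = {p} ∧ M.R a = Icc u v ∧ M.R0 a = Ioo u v ∧
      M.Gr a = {p} ×ˢ Icc u v ∧ M.G0 a = {p} ×ˢ Ioo u v := by
  obtain ⟨p, hp, hD⟩ := M.D_A12 a (Or.inl ha)
  obtain ⟨u, hu, v, hv, huv, hR, hPR⟩ := M.R_A1 a ha
  have hR0 : M.R0 a = Ioo u v := by rw [M.R0_A01 a (Or.inr ha), hR, interior_Icc]
  refine ⟨p, hp, u, hu, v, hv, huv, ?_, hD, ?_, hR, hR0, ?_, ?_⟩
  · intro r hr hruv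
    have : r ∈ ({u, v} : Set ℝ) := hPR ▸ ⟨Ioo_subset_Icc_self hruv, hr⟩
    rcases this with h | h
    · exact hruv.1.ne' h
    · exact hruv.2.ne h
  · rw [M.D0_A12 a (Or.inl ha), hD]
  · rw [M.Gr_A12 a (Or.inl ha), hD, hR]
  · rw [M.G0_A1 a ha, hD, hR0]

/-- Explicit description of the data of a symbol in `A₂`. -/
lemma A2_data {a : M.A} (ha : a ∈ M.A2) :
    ∃ p ∈ M.P, ∃ u ∈ M.P, M.D a = {p} ∧ M.D0 a = {p} ∧ M.R a = {u} ∧ M.R0 a = {u} ∧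
      M.Gr a = {p} ×ˢ {u} ∧ M.G0 a = {p} ×ˢ {u} := by
  obtain ⟨p, hp, hD⟩ := M.D_A12 a (Or.inr ha)
  obtain ⟨u, hu, hR⟩ := M.R_A2 a ha
  have hG : M.Gr a = {p} ×ˢ {u} := by rw [M.Gr_A12 a (Or.inr ha), hD, hR]
  refine ⟨p, hp, u, hu, hD, ?_, hR, ?_, hG, ?_⟩
  · rw [M.D0_A12 a (Or.inr ha), hD]
  · rw [M.R0_A2 a ha, hR]
  · rw [M.G0_A2 a ha, hG]

lemma G0_subset_Gr (a : M.A) : M.G0 a ⊆ M.Gr a := by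
  rcases M.A_cover a with h | h | h
  · rw [M.G0_A0 a h, M.Gr_A0 a h, M.D0_A0 a h]
    exact fun q hq => ⟨interior_subset hq.1, hq.2⟩
  · obtain ⟨p, -, u, -, v, -, -, -, -, -, -, -, hG, hG0⟩ := A1_data h
    rw [hG, hG0]
    exact prod_mono_right Ioo_subset_Icc_self
  · exact (M.G0_A2 a h).subset

lemma Gr_subset_GF (a : M.A) : M.Gr a ⊆ M.GF := subset_iUnion M.Gr a

lemma isClosed_Gr (a : M.A) : IsClosed (M.Gr a) := by
  rcases M.A_cover a with h | h | h
  · obtain ⟨p, -, q, -, -, -, hD⟩ := M.D_A0 a h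
    have hc := (M.f_homeo a h).1
    have : M.Gr a = (fun x => (x, M.f a x)) '' M.D a := by
      rw [M.Gr_A0 a h]
      ext ⟨s, t⟩
      constructor
      · rintro ⟨hs, ht⟩
        exact ⟨s, hs, Prod.ext rfl ht.symm⟩
      · rintro ⟨s', hs', h'⟩
        obtain ⟨rfl, rfl⟩ := Prod.mk.inj h'
        exact ⟨hs', rfl⟩
    rw [this]
    rw [hD] at hc ⊢
    exact (isCompact_Icc.image_of_continuousOn (continuousOn_id.prodMk hc)).isClosed
  · obtain ⟨p, -, u, -, v, -, -, -, -, -, -, -, hG, -⟩ := A1_data h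
    rw [hG]
    exact isClosed_singleton.prod isClosed_Icc
  · obtain ⟨p, -, u, -, -, -, -, -, hG, -⟩ := A2_data h
    rw [hG]
    exact isClosed_singleton.prod isClosed_singleton

/-- A point of `G(a)` is determined by its second coordinate. -/
lemma Gr_fst_unique {a : M.A} {s s' t : ℝ} (h : (s, t) ∈ M.Gr a) (h' : (s', t) ∈ M.Gr a) :
    s = s' := by
  by_cases ha : a ∈ M.A0
  · rw [M.Gr_A0 a ha] at h h'
    exact (M.f_homeo a ha).2.injOn h.1 h'.1 (h.2.symm.trans h'.2)
  · have ha' : a ∈ M.A1 ∪ M.A2 := (M.A_cover a).resolve_left ha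
    obtain ⟨p, -, hD⟩ := M.D_A12 a ha'
    rw [M.Gr_A12 a ha', hD] at h h'
    exact h.1.trans h'.1.symm

lemma fst_mem_D0 {a : M.A} {s t : ℝ} (h : (s, t) ∈ M.G0 a) : s ∈ M.D0 a := by
  rcases M.A_cover a with ha | ha | ha
  · rw [M.G0_A0 a ha] at h
    exact h.1
  · rw [M.G0_A1 a ha] at h
    rw [M.D0_A12 a (Or.inl ha)]
    exact h.1
  · rw [M.G0_A2 a ha, M.Gr_A12 a (Or.inr ha)] at h
    rw [M.D0_A12 a (Or.inr ha)]
    exact h.1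

lemma snd_mem_R0 {a : M.A} {s t : ℝ} (h : (s, t) ∈ M.G0 a) : t ∈ M.R0 a := by
  rcases M.A_cover a with ha | ha | ha
  · obtain ⟨p, -, q, -, u, -, v, -, -, -, -, -, hD0, -, hR0, -, -, hm⟩ := A0_data ha
    rw [M.G0_A0 a ha, hD0] at h
    obtain ⟨h1, h2⟩ := h
    rw [hR0]
    dsimp only at h1 h2
    rw [h2]
    exact hm h1
  · rw [M.G0_A1 a ha] at h
    exact h.2
  · rw [M.G0_A2 a ha, M.Gr_A12 a (Or.inr ha)] at h
    rw [M.R0_A2 a ha]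
    exact h.2

lemma mem_P_of_mem_Gr_of_notMem_G0 {a : M.A} {s t : ℝ} (h : (s, t) ∈ M.Gr a)
    (h0 : (s, t) ∉ M.G0 a) : s ∈ M.P ∧ t ∈ M.P := by
  rcases M.A_cover a with ha | ha | ha
  · obtain ⟨p, hp, q, hq, u, -, v, -, -, -, -, hD, hD0, -, -, hfp, hfq, -⟩ := A0_data ha
    rw [M.Gr_A0 a ha, hD] at h
    rw [M.G0_A0 a ha, hD0] at h0
    obtain ⟨h1 : s ∈ Icc p q, h2 : t = M.f a s⟩ := h
    rcases eq_endpoints_or_mem_Ioo_of_mem_Icc h1 with rfl | rfl | h3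
    · exact ⟨hp, h2 ▸ hfp⟩
    · exact ⟨hq, h2 ▸ hfq⟩
    · exact absurd ⟨h3, h2⟩ h0
  · obtain ⟨p, hp, u, hu, v, hv, -, -, -, -, -, -, hG, hG0⟩ := A1_data ha
    rw [hG] at h
    rw [hG0] at h0
    obtain ⟨h1, h2⟩ := h
    have h1' : s = p := h1
    rcases eq_endpoints_or_mem_Ioo_of_mem_Icc h2 with h3 | h3 | h3
    · exact ⟨h1' ▸ hp, (show t = u from h3) ▸ hu⟩
    · exact ⟨h1' ▸ hp, (show t = v from h3) ▸ hv⟩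
    · exact absurd ⟨h1, h3⟩ h0
  · exact absurd (M.G0_A2 a ha ▸ h) h0

lemma notMem_A0_of_mem_P {a : M.A} {s : ℝ} (h : s ∈ M.D0 a) (hs : s ∈ M.P) : a ∉ M.A0 := by
  intro ha
  obtain ⟨p, -, q, -, u, -, v, -, -, -, hgap, -, hD0, -⟩ := A0_data ha
  rw [hD0] at h
  exact hgap s hs h

lemma mem_A2_of_mem_P {a : M.A} {s t : ℝ} (h : (s, t) ∈ M.G0 a) (hs : s ∈ M.P)
    (ht : t ∈ M.P) : a ∈ M.A2 := by
  refine mem_A2_of_notMem (notMem_A0_of_mem_P (fst_mem_D0 h) hs) fun ha => ?_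
  obtain ⟨p, -, u, -, v, -, -, hgap, -, -, -, hR0, -, -⟩ := A1_data ha
  exact hgap t ht (hR0 ▸ snd_mem_R0 h)

/-- Away from `A₂`, the open cell `G₀(a)` avoids the closed cells of all other symbols. -/
lemma eq_of_mem_G0_of_mem_Gr (hpp : M.ProperlyParametrized) {a b : M.A} {s t : ℝ}
    (ha : a ∉ M.A2) (h : (s, t) ∈ M.G0 a) (hb : (s, t) ∈ M.Gr b) : b = a := by
  by_contra hne
  have hb0 : (s, t) ∉ M.G0 b := fun hb0 =>
    disjoint_left.1 (hpp.2 b a hne) hb0 h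
  obtain ⟨hs, ht⟩ := mem_P_of_mem_Gr_of_notMem_G0 hb hb0
  exact ha (mem_A2_of_mem_P h hs ht)

lemma exists_mem_G0 (hpp : M.ProperlyParametrized) {q : ℝ × ℝ} (h : q ∈ M.GF) :
    ∃ a, q ∈ M.G0 a := by
  rw [← hpp.1] at h
  exact mem_iUnion.1 h

lemma G0_unique (hpp : M.ProperlyParametrized) {q : ℝ × ℝ} {a b : M.A}
    (ha : q ∈ M.G0 a) (hb : q ∈ M.G0 b) : a = b := by
  by_contra hne
  exact disjoint_left.1 (hpp.2 a b hne) ha hb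

/-- The Markov property: a point of `R₀(a) ∩ D₀(b)` forces `D₀(b) ⊆ R₀(a)`. -/
lemma D0_subset_R0 {a b : M.A} {t : ℝ} (hR : t ∈ M.R0 a) (hD : t ∈ M.D0 b) :
    M.D0 b ⊆ M.R0 a := by
  by_cases hb : b ∈ M.A0
  · obtain ⟨p, -, q, -, -, -, -, -, -, -, hgap, -, hD0, -⟩ := A0_data hb
    have key : ∀ u ∈ M.P, ∀ v ∈ M.P, M.R0 a = Ioo u v → M.D0 b ⊆ M.R0 a := by
      intro u hu v hv hR0
      rw [hR0] at hR ⊢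
      rw [hD0] at hD ⊢
      refine Ioo_subset_Ioo ?_ ?_
      · by_contra! hlt
        exact hgap u hu ⟨hlt, hR.1.trans hD.2⟩
      · by_contra! hlt
        exact hgap v hv ⟨hD.1.trans hR.2, hlt⟩
    rcases M.A_cover a with ha | ha | ha
    · obtain ⟨-, -, -, -, u, hu, v, hv, -, -, -, -, -, -, hR0, -⟩ := A0_data ha
      exact key u hu v hv hR0
    · obtain ⟨-, -, u, hu, v, hv, -, -, -, -, -, hR0, -⟩ := A1_data ha
      exact key u hu v hv hR0
    · obtain ⟨-, -, u, hu, -, -, -, hR0, -⟩ := A2_data ha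
      have : t = u := by rw [hR0] at hR; exact hR
      exact absurd hb (notMem_A0_of_mem_P hD (this ▸ hu))
  · have hb' : b ∈ M.A1 ∪ M.A2 := (M.A_cover b).resolve_left hb
    obtain ⟨p, -, hDp⟩ := M.D_A12 b hb'
    rw [M.D0_A12 b hb', hDp] at hD ⊢
    rw [mem_singleton_iff] at hD
    rw [singleton_subset_iff, ← hD]
    exact hR

lemma R_subset (a : M.A) : M.R a ⊆ Icc 0 1 := by
  have key : ∀ u ∈ M.P, ∀ v ∈ M.P, M.R a = Icc u v → M.R a ⊆ Icc 0 1 := by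
    intro u hu v hv hR
    rw [hR]
    exact Icc_subset_Icc (M.P_sub hu).1 (M.P_sub hv).2
  rcases M.A_cover a with ha | ha | ha
  · obtain ⟨u, hu, v, hv, -, hR⟩ := M.R_A0 a ha
    exact key u hu v hv hR
  · obtain ⟨u, hu, v, hv, -, hR, -⟩ := M.R_A1 a ha
    exact key u hu v hv hR
  · obtain ⟨u, hu, hR⟩ := M.R_A2 a ha
    exact key u hu u hu (by rw [hR, Icc_self])

lemma exists_next {s : ℝ} (hs : s ∈ Icc (0 : ℝ) 1) :
    ∃ t ∈ Icc (0 : ℝ) 1, (s, t) ∈ M.GF := by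
  rw [M.cover] at hs
  obtain ⟨a, ha⟩ := mem_iUnion.1 hs
  suffices ∃ t ∈ M.R a, (s, t) ∈ M.Gr a by
    obtain ⟨t, ht, hG⟩ := this
    exact ⟨t, R_subset a ht, Gr_subset_GF a hG⟩
  rcases M.A_cover a with h | h | h
  · exact ⟨M.f a s, (M.f_homeo a h).2.mapsTo ha, by rw [M.Gr_A0 a h]; exact ⟨ha, rfl⟩⟩
  · obtain ⟨u, -, v, -, huv, hR, -⟩ := M.R_A1 a h
    have hu : u ∈ M.R a := hR ▸ left_mem_Icc.2 huv.le
    exact ⟨u, hu, by rw [M.Gr_A12 a (Or.inl h)]; exact ⟨ha, hu⟩⟩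
  · obtain ⟨u, -, hR⟩ := M.R_A2 a h
    have hu : u ∈ M.R a := hR ▸ mem_singleton u
    exact ⟨u, hu, by rw [M.Gr_A12 a (Or.inr h)]; exact ⟨ha, hu⟩⟩

/-- Every finite trajectory extends to an infinite forward trajectory. -/
lemma exists_extension {n : ℕ} {y : Fin (n + 1) → ℝ} (hy : y ∈ M.finTraj (n + 1)) :
    ∃ x ∈ M.X, ∀ i : Fin (n + 1), x i = y i := by
  have hnext : ∀ s : ℝ, ∃ t : ℝ, s ∈ Icc (0 : ℝ) 1 → t ∈ Icc (0 : ℝ) 1 ∧ (s, t) ∈ M.GF := by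
    intro s
    by_cases hs : s ∈ Icc (0 : ℝ) 1
    · obtain ⟨t, ht⟩ := M.exists_next hs
      exact ⟨t, fun _ => ht⟩
    · exact ⟨0, fun h => absurd h hs⟩
  choose F hF using hnext
  let x : ℕ → ℝ := fun k =>
    Nat.rec (y 0) (fun j t => if h : j + 1 < n + 1 then y ⟨j + 1, h⟩ else F t) k
  have hx0 : x 0 = y 0 := rfl
  have hxs : ∀ j, x (j + 1) = if h : j + 1 < n + 1 then y ⟨j + 1, h⟩ else F (x j) :=
    fun j => rfl
  have hxy : ∀ i : Fin (n + 1), x i = y i := by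
    rintro ⟨i, hi⟩
    cases i with
    | zero => exact hx0
    | succ j => exact (hxs j).trans (dif_pos hi)
  have hI : ∀ k, x k ∈ Icc (0 : ℝ) 1 := by
    intro k
    induction k with
    | zero => exact hx0 ▸ hy.1 0
    | succ j ih =>
      rw [hxs]
      split_ifs with h
      · exact hy.1 _
      · exact (hF _ ih).1
  refine ⟨x, ⟨hI, fun k => ?_⟩, hxy⟩
  by_cases h : k + 1 < n + 1
  · have := hy.2 ⟨k, by omega⟩ h
    rwa [← hxy, ← hxy] at this
  · rw [hxs, dif_neg h]
    exact (hF _ (hI k)).2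

/-- The label sequence of a forward trajectory lies in `Σ_M`. -/
lemma mem_SFT_of_mem_G0 {x : ℕ → ℝ} {a : ℕ → M.A}
    (h : ∀ k, (x k, x (k + 1)) ∈ M.G0 (a k)) : a ∈ M.SFT :=
  fun k => D0_subset_R0 (snd_mem_R0 (h k)) (fst_mem_D0 (h (k + 1)))

lemma finTraj_step {n : ℕ} (y : M.finTraj (n + 1)) (i : Fin n) :
    (y.1 i.castSucc, y.1 i.succ) ∈ M.GF :=
  y.2.2 i.castSucc (by simp)

lemma continuous_finTraj_step {n : ℕ} (i : Fin n) :
    Continuous fun y : M.finTraj (n + 1) => (y.1 i.castSucc, y.1 i.succ) :=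
  ((continuous_apply _).comp continuous_subtype_val).prodMk
    ((continuous_apply _).comp continuous_subtype_val)

/-- Finite trajectories close to `x` have labels that are (non-strict) labels of `x`. -/
lemma eventually_label {n : ℕ} (x : M.finTraj (n + 1)) (i : Fin n) :
    ∀ᶠ y in 𝓝 x, ∀ b : M.A, (y.1 i.castSucc, y.1 i.succ) ∈ M.Gr b →
      (x.1 i.castSucc, x.1 i.succ) ∈ M.Gr b := by
  have := M.finA
  rw [Filter.eventually_all]
  intro b
  by_cases hb : (x.1 i.castSucc, x.1 i.succ) ∈ M.Gr b
  · exact Filter.Eventually.of_forall fun _ _ => hb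
  · have := (continuous_finTraj_step i).continuousAt.eventually
      ((isClosed_Gr b).isOpen_compl.mem_nhds hb)
    filter_upwards [this] with y hy hy'
    exact absurd hy' hy

/-- If the last letter is not in `A₂`, then special labelling by `u` is an open condition. -/
lemma isOpen_specialLabeled (hpp : M.ProperlyParametrized) {n : ℕ} {u : Fin (n + 1) → M.A}
    (hu : u (Fin.last n) ∉ M.A2) :
    IsOpen {x : M.finTraj (n + 1 + 1) | M.SpecialLabeled x.1 u} := by
  rw [isOpen_iff_eventually]
  intro x hx
  have key : ∀ i, ∀ᶠ y : M.finTraj (n + 1 + 1) in 𝓝 x,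
      (y.1 i.castSucc, y.1 i.succ) ∈ M.G0 (u i) := by
    have hbase : ∀ i, u i ∉ M.A2 → ∀ᶠ y : M.finTraj (n + 1 + 1) in 𝓝 x,
        (y.1 i.castSucc, y.1 i.succ) ∈ M.G0 (u i) := by
      intro i hi
      filter_upwards [eventually_label x i] with y hy
      obtain ⟨b, hb⟩ := exists_mem_G0 hpp (finTraj_step y i)
      rwa [← eq_of_mem_G0_of_mem_Gr hpp hi (hx i) (hy b (G0_subset_Gr b hb))]
    intro i
    induction i using Fin.reverseInduction with
    | last => exact hbase _ hu
    | cast i ih =>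
      by_cases hi : u i.castSucc ∈ M.A2
      · obtain ⟨p, -, t, ht, -, -, -, -, -, hG0⟩ := A2_data hi
        have hx1 := hx i.castSucc
        have hx2 := hx i.succ
        rw [hG0] at hx1
        have hxP : x.1 i.succ.castSucc ∈ M.P := by
          have h : x.1 i.castSucc.succ = t := hx1.2
          rw [← Fin.succ_castSucc, h]
          exact ht
        have hA0 := notMem_A0_of_mem_P (fst_mem_D0 hx2) hxP
        have hA12 := (M.A_cover (u i.succ)).resolve_left hA0
        obtain ⟨r, -, hDr⟩ := M.D_A12 _ hA12
        have hD0 : M.D0 (u i.succ) = {r} := by rw [M.D0_A12 _ hA12, hDr]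
        filter_upwards [ih, eventually_label x i.castSucc] with y hy1 hy2
        have e1 : y.1 i.castSucc.succ = x.1 i.castSucc.succ := by
          have h1 := fst_mem_D0 hy1
          have h2 := fst_mem_D0 hx2
          rw [hD0, mem_singleton_iff] at h1 h2
          rw [Fin.succ_castSucc, h1, h2]
        obtain ⟨b, hb⟩ := mem_iUnion.1 (finTraj_step y i.castSucc)
        have hb' := hy2 b hb
        rw [e1] at hb
        rw [Gr_fst_unique hb hb', e1]
        exact hx i.castSucc
      · exact hbase _ hi
  exact Filter.eventually_all.2 key

/-- A labeled finite trajectory is determined by its labels and its last point. -/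
lemma eq_of_specialLabeled {n : ℕ} {u : Fin n → M.A} {x y : Fin (n + 1) → ℝ}
    (hx : M.SpecialLabeled x u) (hy : M.SpecialLabeled y u)
    (h : x (Fin.last n) = y (Fin.last n)) : x = y := by
  funext i
  induction i using Fin.reverseInduction with
  | last => exact h
  | cast i ih =>
    have h1 := G0_subset_Gr _ (hx i)
    have h2 := G0_subset_Gr _ (hy i)
    rw [ih] at h1
    exact Gr_fst_unique h1 h2

lemma exists_specialLabeled (hpp : M.ProperlyParametrized) {n : ℕ} (y : M.finTraj (n + 1)) :
    ∃ u : Fin n → M.A, M.SpecialLabeled y.1 u := by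
  choose u hu using fun i => exists_mem_G0 hpp (finTraj_step y i)
  exact ⟨u, hu⟩

lemma last_mem_P {n : ℕ} {u : Fin (n + 1) → M.A} {x : Fin (n + 1 + 1) → ℝ}
    (hx : M.SpecialLabeled x u) (hu : u (Fin.last n) ∈ M.A2) :
    x (Fin.last (n + 1)) ∈ M.P := by
  obtain ⟨p, -, t, ht, -, -, -, -, -, hG0⟩ := A2_data hu
  have h := hx (Fin.last n)
  rw [hG0] at h
  have : x (Fin.last (n + 1)) = t := h.2
  exact this ▸ ht

/-- Every nonempty open set of finite trajectories contains a trajectory whose special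
labelling word defines an open set. -/
lemma exists_isOpen_specialLabeled (hpp : M.ProperlyParametrized) {n : ℕ}
    {W : Set (M.finTraj (n + 1 + 1))} (hW : IsOpen W) (hne : W.Nonempty) :
    ∃ y ∈ W, ∃ u : Fin (n + 1) → M.A, M.SpecialLabeled y.1 u ∧
      IsOpen {x : M.finTraj (n + 1 + 1) | M.SpecialLabeled x.1 u} := by
  by_cases hgood : ∃ y ∈ W, ∃ u : Fin (n + 1) → M.A,
      M.SpecialLabeled y.1 u ∧ u (Fin.last n) ∉ M.A2
  · obtain ⟨y, hy, u, hu, hlast⟩ := hgood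
    exact ⟨y, hy, u, hu, isOpen_specialLabeled hpp hlast⟩
  push Not at hgood
  have := M.finA
  choose lab hlab using fun y : M.finTraj (n + 1 + 1) => exists_specialLabeled hpp y
  have hfin : W.Finite := by
    refine Finite.of_finite_image (f := fun y => (lab y, y.1 (Fin.last (n + 1)))) ?_ ?_
    · refine ((finite_univ (α := Fin (n + 1) → M.A)).prod M.P.finite_toSet).subset ?_
      rintro _ ⟨y, hy, rfl⟩
      exact ⟨mem_univ _, last_mem_P (hlab y) (hgood y hy _ (hlab y))⟩
    · intro y _ z _ hyz
      obtain ⟨h1, h2⟩ := Prod.mk.inj hyz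
      exact Subtype.ext (eq_of_specialLabeled (hlab y) (h1 ▸ hlab z) h2)
  obtain ⟨y, hy⟩ := hne
  refine ⟨y, hy, lab y, hlab y, ?_⟩
  have hsingle : {x : M.finTraj (n + 1 + 1) | M.SpecialLabeled x.1 (lab y)} = {y} := by
    ext x
    refine ⟨fun hx => Subtype.ext (eq_of_specialLabeled hx (hlab y) ?_), ?_⟩
    · obtain ⟨p, -, t, -, -, -, -, -, -, hG0⟩ := A2_data (hgood y hy _ (hlab y))
      have h1 := hx (Fin.last n)
      have h2 := hlab y (Fin.last n)
      rw [hG0] at h1 h2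
      exact h1.2.trans h2.2.symm
    · rintro rfl
      exact hlab x
  have hrest : IsClosed (W \ {y}) := (hfin.subset sdiff_subset).isClosed
  have : W \ (W \ {y}) = {y} := by
    rw [sdiff_sdiff_right_self]
    exact inter_eq_right.2 (singleton_subset_iff.2 hy)
  rw [hsingle, ← this]
  exact hW.sdiff hrest

/-- `x` is a forward trajectory with special label sequence `a`. -/
def IsLabeling (M : MarkovMultiMap) (x : ℕ → ℝ) (a : ℕ → M.A) : Prop :=
  x ∈ M.X ∧ ∀ k, (x k, x (k + 1)) ∈ M.G0 (a k)

/-- Restriction of a forward trajectory to its first coordinates. -/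
def restrict {x : ℕ → ℝ} (hx : x ∈ M.X) (n : ℕ) : M.finTraj n :=
  ⟨fun i => x i, fun i => hx.1 i, fun i _ => hx.2 i.1⟩

/-- Truncation of finite trajectories. -/
def trunc {m n : ℕ} (h : m ≤ n) (y : M.finTraj n) : M.finTraj m :=
  ⟨fun i => y.1 (Fin.castLE h i), fun _ => y.2.1 _,
    fun i hi => y.2.2 (Fin.castLE h i) (lt_of_lt_of_le hi h)⟩

lemma continuous_trunc {m n : ℕ} (h : m ≤ n) :
    Continuous (trunc h : M.finTraj n → M.finTraj m) :=
  Continuous.subtype_mk (f := fun (y : M.finTraj n) (i : Fin m) => y.1 (Fin.castLE h i))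
    (continuous_pi fun _ => (continuous_apply _).comp continuous_subtype_val) _

/-- Every nonempty open set of finite trajectories meets the cylinder of an infinite
trajectory whose initial label word is essential. -/
lemma exists_labeling_essential (hpp : M.ProperlyParametrized) {n : ℕ}
    {W : Set (M.finTraj (n + 1 + 1))} (hW : IsOpen W) (hne : W.Nonempty) :
    ∃ x a, ∃ h : M.IsLabeling x a, restrict h.1 (n + 1 + 1) ∈ W ∧
      M.EssentialWord fun i : Fin (n + 1) => a i := by
  obtain ⟨y, hy, u, hu, hopen⟩ := exists_isOpen_specialLabeled hpp hW hne
  obtain ⟨x, hx, hxy⟩ := exists_extension y.2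
  choose a ha using fun k => exists_mem_G0 hpp (hx.2 k)
  have hau : (fun i : Fin (n + 1) => a i) = u := by
    funext i
    have h := hu i
    rw [← hxy, ← hxy] at h
    exact G0_unique hpp (ha i) h
  refine ⟨x, a, ⟨hx, ha⟩, ?_, ⟨a, mem_SFT_of_mem_G0 ha, 0, fun i => by simp⟩, ?_⟩
  · convert hy
    exact Subtype.ext (funext hxy)
  · rw [hau]
    exact hopen

/-- An initial essential label word can be prolonged to a longer one, staying in a
prescribed open set. -/
lemma exists_essential_prolongation (hpp : M.ProperlyParametrized) {n m : ℕ} (hnm : n ≤ m + 1)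
    {W : Set (M.finTraj n)} (hW : IsOpen W) {x : ℕ → ℝ} {a : ℕ → M.A}
    (h : M.IsLabeling x a) (hxW : restrict h.1 n ∈ W)
    (hess : M.EssentialWord fun i : Fin m => a i) :
    ∃ x' a', ∃ h' : M.IsLabeling x' a', restrict h'.1 n ∈ W ∧
      (M.EssentialWord fun i : Fin (m + 1) => a' i) ∧ ∀ k < m, a' k = a k := by
  obtain ⟨x', a', h', hW', hess'⟩ := exists_labeling_essential hpp (n := m)
    (W := trunc (show n ≤ m + 1 + 1 by omega) ⁻¹' W ∩
      trunc (show m + 1 ≤ m + 1 + 1 by omega) ⁻¹'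
        {y | M.SpecialLabeled y.1 fun i : Fin m => a i})
    ((hW.preimage (continuous_trunc _)).inter (hess.2.preimage (continuous_trunc _)))
    ⟨restrict h.1 _, hxW, fun i => h.2 i⟩
  exact ⟨x', a', h', hW'.1, hess',
    fun k hk => G0_unique hpp (h'.2 k) (hW'.2 ⟨k, hk⟩)⟩

end MarkovMultiMap

/-- If `U ⊆ X_{n+2}` is relatively open and its preimage under the projection
`π : X → X_{n+2}` is nonempty, then it contains a finite trajectory specially labeled
by a word occurring in `E`. -/
theorem stmt9 (M : MarkovMultiMap) (hpp : M.ProperlyParametrized)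
    (n : ℕ) (Un : Set (Fin (n + 2) → ℝ)) (hsub : Un ⊆ M.finTraj (n + 2))
    (hopen : ∃ V : Set (Fin (n + 2) → ℝ), IsOpen V ∧ Un = V ∩ M.finTraj (n + 2))
    (hne : ∃ x ∈ M.X, (fun i : Fin (n + 2) => x (i : ℕ)) ∈ Un) :
    ∃ z ∈ Un, ∃ u : Fin (n + 1) → M.A, M.WordIn u M.E ∧ M.SpecialLabeled z u := by
  obtain ⟨V, hV, hUV⟩ := hopen
  obtain ⟨x₀, hx₀, hx₀U⟩ := hne
  let W : Set (M.finTraj (n + 2)) := Subtype.val ⁻¹' V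
  have hW : IsOpen W := hV.preimage continuous_subtype_val
  have hWU : ∀ y : M.finTraj (n + 2), y ∈ W → y.1 ∈ Un := fun y hy => hUV ▸ ⟨hy, y.2⟩
  have hWne : W.Nonempty :=
    ⟨MarkovMultiMap.restrict hx₀ (n + 2), (hUV ▸ hx₀U : _ ∈ V ∩ M.finTraj (n + 2)).1⟩
  obtain ⟨x₁, a₁, h₁, hW₁, hess₁⟩ :=
    MarkovMultiMap.exists_labeling_essential hpp hW hWne
  let S : ℕ → (ℕ → ℝ) × (ℕ → M.A) → Prop := fun j s =>
    ∃ h : M.IsLabeling s.1 s.2, MarkovMultiMap.restrict h.1 (n + 2) ∈ W ∧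
      M.EssentialWord fun i : Fin (n + 1 + j) => s.2 i
  have hstep : ∀ j (s : {s // S j s}), ∃ s' : {s // S (j + 1) s},
      ∀ k < n + 1 + j, s'.1.2 k = s.1.2 k := by
    rintro j ⟨s, h, hsW, hess⟩
    obtain ⟨x', a', h', hW', hess', hag⟩ :=
      MarkovMultiMap.exists_essential_prolongation hpp (by omega) hW h hsW hess
    exact ⟨⟨(x', a'), h', hW', hess'⟩, hag⟩
  choose next hnext using hstep
  let s : ∀ j, {s // S j s} := fun j =>
    Nat.rec (motive := fun j => {s // S j s}) ⟨(x₁, a₁), h₁, hW₁, hess₁⟩ next j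
  have hs : ∀ j, ∀ k < n + 1 + j, (s (j + 1)).1.2 k = (s j).1.2 k := fun j => hnext j (s j)
  have hs' : ∀ i j, i ≤ j → ∀ k < n + 1 + i, (s j).1.2 k = (s i).1.2 k := by
    intro i j hij k hk
    induction j, hij using Nat.le_induction with
    | base => rfl
    | succ j hij ih => exact (hs j k (by omega)).trans ih
  refine ⟨_, hWU _ hW₁, fun i => a₁ i, ⟨fun k => (s k).1.2 k, ⟨fun k => ?_, fun k => ?_⟩, 0, ?_⟩,
    fun i => h₁.2 i⟩
  · have h := (s (k + 1)).2.choose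
    have := MarkovMultiMap.mem_SFT_of_mem_G0 h.2 k
    rwa [hs' k (k + 1) (by omega) k (by omega)] at this
  · obtain ⟨-, -, hess⟩ := (s k).2
    exact ⟨_, _, hess, ⟨k, by omega⟩, rfl⟩
  · intro i
    rw [Nat.zero_add]
    exact (hs' 0 i (by omega) i (by omega)).symm
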